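/- For Δ ≥ 3 and n ≥ Δ + 1, Kf(P_{n,Δ}^3) = (n−Δ+1)(n−Δ+2)(n+2Δ−9)/6 + (Δ−3)(Δ−2/3) + (n−Δ)² + 7(n−Δ)/3 + 2. -/

import Mathlib

open scoped Classical

noncomputable section

namespace KfPaper

variable {V : Type*} {W : Type*}

/-- The energy of a potential `f` on graph `G`, viewing each edge as a unit resistor:
`(1/2) · ∑_{x,y adjacent} (f x - f y)²` (each edge counted twice, hence the `1/2`). -/
def energy [Fintype V] (G : SimpleGraph V) (f : V → ℝ) : ℝ :=
  (1 / 2) * ∑ x : V, ∑ y : V, (if G.Adj x y then (f x - f y) ^ 2 else 0)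

/-- The resistance distance (effective resistance) between `u` and `v`:
`r(u,v) = 1 / inf { energy f : f u = 1, f v = 0 }` and `r(u,u) = 0`. -/
def resistanceDistance [Fintype V] (G : SimpleGraph V) (u v : V) : ℝ :=
  if u = v then 0
  else 1 / sInf {e : ℝ | ∃ f : V → ℝ, f u = 1 ∧ f v = 0 ∧ energy G f = e}

/-- The Kirchhoff index: sum of resistance distances over unordered pairs of distinct
vertices (each ordered pair counted once via the factor `1/2`, diagonal terms vanish). -/
def kirchhoffIndex [Fintype V] (G : SimpleGraph V) : ℝ :=
  (1 / 2) * ∑ u : V, ∑ v : V, resistanceDistance G u v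

/-- `Kf_v(G) = ∑_{u ≠ v} r(v,u)` (the term `u = v` contributes `0`). -/
def kirchhoffAt [Fintype V] (G : SimpleGraph V) (v : V) : ℝ :=
  ∑ u : V, resistanceDistance G v u

/-- The Wiener index: sum of graph distances over unordered pairs of distinct vertices. -/
def wienerIndex [Fintype V] (G : SimpleGraph V) : ℝ :=
  (1 / 2) * ∑ u : V, ∑ v : V, (G.dist u v : ℝ)

/-- `W_v(G) = ∑_u d(v,u)`. -/
def wienerAt [Fintype V] (G : SimpleGraph V) (v : V) : ℝ :=
  ∑ u : V, (G.dist v u : ℝ)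

/-- The degree of a vertex. -/
def degree' (G : SimpleGraph V) (v : V) : ℕ := Nat.card (G.neighborSet v)

/-- `G` has maximum degree `Δ`. -/
def HasMaxDegree (G : SimpleGraph V) (Δ : ℕ) : Prop :=
  (∀ v, degree' G v ≤ Δ) ∧ ∃ v, degree' G v = Δ

/-- A unicyclic graph: a connected graph containing exactly one cycle, equivalently a
connected graph with as many edges as vertices. -/
def IsUnicyclic [Fintype V] (G : SimpleGraph V) : Prop :=
  G.Connected ∧ Nat.card G.edgeSet = Fintype.card V

/-- `P_{n,Δ}^3`: the unicyclic graph on `Fin n` with a triangle on `0,1,2`, with `Δ−3`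
pendant vertices `3,…,Δ−1` attached to the triangle vertex `2`, and one end-vertex of the
path `Δ, Δ+1, …, n−1` (on `n−Δ` vertices) attached to `2` (so `2` has degree `Δ`). -/
def PnD3 (n Δ : ℕ) : SimpleGraph (Fin n) :=
  SimpleGraph.fromRel (fun i j =>
    (i.val = 0 ∧ j.val = 1) ∨ (i.val = 0 ∧ j.val = 2) ∨ (i.val = 1 ∧ j.val = 2) ∨
    (i.val = 2 ∧ 3 ≤ j.val ∧ j.val ≤ Δ) ∨
    (Δ ≤ i.val ∧ j.val = i.val + 1))

section EnergyForm

variable [Fintype V]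

/-- The symmetric bilinear form whose quadratic form is `energy`. -/
def energyForm (G : SimpleGraph V) (f g : V → ℝ) : ℝ :=
  (1 / 2) * ∑ x : V, ∑ y : V, (if G.Adj x y then (f x - f y) * (g x - g y) else 0)

theorem energyForm_self (G : SimpleGraph V) (f : V → ℝ) : energyForm G f f = energy G f := by
  simp only [energyForm, energy, sq]

theorem energy_nonneg (G : SimpleGraph V) (f : V → ℝ) : 0 ≤ energy G f := by
  unfold energy
  refine mul_nonneg (by norm_num) (Finset.sum_nonneg fun x _ => Finset.sum_nonneg fun y _ => ?_)
  split_ifs <;> positivity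

theorem energy_sub_smul (G : SimpleGraph V) (f g : V → ℝ) (t : ℝ) :
    energy G (fun x => f x - t * g x)
      = energy G f - 2 * t * energyForm G g f + t ^ 2 * energy G g := by
  simp only [energy, energyForm, Finset.mul_sum, ← Finset.sum_sub_distrib,
    ← Finset.sum_add_distrib]
  refine Finset.sum_congr rfl fun x _ => Finset.sum_congr rfl fun y _ => ?_
  split_ifs <;> ring

theorem energyForm_sub_left (G : SimpleGraph V) (f g h : V → ℝ) :
    energyForm G (fun x => f x - g x) h = energyForm G f h - energyForm G g h := by
  simp only [energyForm, Finset.mul_sum, ← Finset.sum_sub_distrib]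
  refine Finset.sum_congr rfl fun x _ => Finset.sum_congr rfl fun y _ => ?_
  split_ifs <;> ring

theorem energy_affine (G : SimpleGraph V) (g : V → ℝ) (c t : ℝ) :
    energy G (fun x => t * (g x - c)) = t ^ 2 * energy G g := by
  simp only [energy, Finset.mul_sum]
  refine Finset.sum_congr rfl fun x _ => Finset.sum_congr rfl fun y _ => ?_
  split_ifs <;> ring

/-- If `g` is a potential for the unit current flow from `u` to `v`, the resistance distance
is the potential drop of `g`. -/
theorem resistanceDistance_eq_of_potential (G : SimpleGraph V) {u v : V} (huv : u ≠ v)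
    (g : V → ℝ) (hg : ∀ f, energyForm G g f = f u - f v) :
    resistanceDistance G u v = g u - g v := by
  have hgg : energy G g = g u - g v := by rw [← energyForm_self, hg]
  have key : ∀ f : V → ℝ, f u = 1 → f v = 0 → ∀ t : ℝ,
      0 ≤ energy G f - 2 * t + t ^ 2 * (g u - g v) := by
    intro f hu hv t
    have h := energy_nonneg G (fun x => f x - t * g x)
    rw [energy_sub_smul, hg, hu, hv, hgg] at h
    linarith
  have hpos : 0 < g u - g v := by
    refine lt_of_le_of_ne (hgg ▸ energy_nonneg G g) fun h0 => ?_
    have h := key (fun x => if x = u then 1 else 0) (by simp) (by simp [huv.symm])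
      (energy G (fun x => if x = u then 1 else 0) + 1)
    rw [← h0] at h
    linarith [energy_nonneg G (fun x => if x = u then 1 else 0)]
  have hleast : IsLeast {e : ℝ | ∃ f : V → ℝ, f u = 1 ∧ f v = 0 ∧ energy G f = e}
      (1 / (g u - g v)) := by
    refine ⟨⟨fun x => 1 / (g u - g v) * (g x - g v), ?_, by simp, ?_⟩, ?_⟩
    · field_simp
    · rw [energy_affine, hgg]
      field_simp
    · rintro e ⟨f, hu, hv, rfl⟩
      have h := key f hu hv (1 / (g u - g v))
      have h2 : (1 / (g u - g v)) ^ 2 * (g u - g v) = 1 / (g u - g v) := by field_simp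
      linarith
  rw [resistanceDistance, if_neg huv, hleast.csInf_eq, one_div_one_div]

/-- Resistance distances in terms of a Green function `K` grounded at the vertex `o`. -/
theorem resistanceDistance_eq_of_green (G : SimpleGraph V) (o : V) (K : V → V → ℝ)
    (hK : ∀ u f, energyForm G (K u) f = f u - f o) (u v : V) :
    resistanceDistance G u v = K u u - K v u - K u v + K v v := by
  by_cases huv : u = v
  · subst huv
    simp [resistanceDistance]
  · rw [resistanceDistance_eq_of_potential G huv (fun x => K u x - K v x)]
    · ring
    · intro f
      rw [energyForm_sub_left, hK, hK]
      ring

theorem kirchhoffIndex_eq_of_green (G : SimpleGraph V) (o : V) (K : V → V → ℝ)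
    (hK : ∀ u f, energyForm G (K u) f = f u - f o) :
    kirchhoffIndex G = Fintype.card V * ∑ u, K u u - ∑ u, ∑ v, K u v := by
  simp only [kirchhoffIndex, resistanceDistance_eq_of_green G o K hK, Finset.sum_add_distrib,
    Finset.sum_sub_distrib, Finset.sum_const, Finset.card_univ, nsmul_eq_mul, ← Finset.mul_sum]
  rw [Finset.sum_comm (f := fun u v => K v u)]
  ring

/-- For a graph generated by an asymmetric relation, the energy form is a sum over related
pairs. -/
theorem energyForm_fromRel (R : V → V → Prop) (hR : ∀ x y, R x y → ¬ R y x) (f g : V → ℝ) :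
    energyForm (SimpleGraph.fromRel R) f g
      = ∑ y, ∑ x, if R x y then (f x - f y) * (g x - g y) else 0 := by
  have h : ∀ x y, (if (SimpleGraph.fromRel R).Adj x y then (f x - f y) * (g x - g y) else 0)
      = (if R x y then (f x - f y) * (g x - g y) else 0)
        + (if R y x then (f y - f x) * (g y - g x) else 0) := by
    intro x y
    have hne : R x y → x ≠ y := fun hxy he => hR x y hxy (by subst he; exact hxy)
    have hne' : R y x → x ≠ y := fun hxy he => hR y x hxy (by subst he; exact hxy)
    have := hR x y
    by_cases h1 : R x y <;> by_cases h2 : R y x <;>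
      simp_all [SimpleGraph.fromRel_adj]
    ring
  have hE : energyForm (SimpleGraph.fromRel R) f g
      = (1 / 2) * ∑ x, ∑ y, ((if R x y then (f x - f y) * (g x - g y) else 0)
        + (if R y x then (f y - f x) * (g y - g x) else 0)) := by
    unfold energyForm
    congr 1
    refine Finset.sum_congr rfl fun x _ => Finset.sum_congr rfl fun y _ => ?_
    convert h x y
  rw [hE]
  simp only [Finset.sum_add_distrib]
  rw [Finset.sum_comm (f := fun x y => if R x y then (f x - f y) * (g x - g y) else 0)]
  ring

end EnergyForm

/-- The relation generating `PnD3 n Δ`, on vertex labels, oriented from smaller to larger. -/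
def edgeRel (Δ i j : ℕ) : Prop :=
  (i = 0 ∧ j = 1) ∨ (i = 0 ∧ j = 2) ∨ (i = 1 ∧ j = 2) ∨
    (i = 2 ∧ 3 ≤ j ∧ j ≤ Δ) ∨ (Δ ≤ i ∧ j = i + 1)

theorem PnD3_eq_fromRel (n Δ : ℕ) :
    PnD3 n Δ = SimpleGraph.fromRel (fun i j : Fin n => edgeRel Δ i j) := rfl

/-- The neighbour of the vertex `j ≥ 3` of `P_{n,Δ}^3` on the side of the triangle. -/
def parent (Δ j : ℕ) : ℕ := if j ≤ Δ then 2 else j - 1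

theorem parent_lt {Δ j : ℕ} (hj : 3 ≤ j) : parent Δ j < j := by
  unfold parent
  split_ifs <;> omega

theorem energyForm_PnD3 {n Δ : ℕ} (hΔ : 3 ≤ Δ) (hn : 3 ≤ n) (F H : ℕ → ℝ) :
    energyForm (PnD3 n Δ) (fun i => F i) (fun i => H i)
      = (F 0 - F 1) * (H 0 - H 1) + (F 0 - F 2) * (H 0 - H 2) + (F 1 - F 2) * (H 1 - H 2)
        + ∑ j ∈ Finset.Ico 3 n, (F j - F (parent Δ j)) * (H j - H (parent Δ j)) := by
  rw [PnD3_eq_fromRel, energyForm_fromRel _ (by intro x y; unfold edgeRel; omega)]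
  have hx : ∀ j : ℕ, (∑ x : Fin n, if edgeRel Δ x j then (F x - F j) * (H x - H j) else 0)
      = ∑ x ∈ Finset.range n, if edgeRel Δ x j then (F x - F j) * (H x - H j) else 0 := fun j =>
    Fin.sum_univ_eq_sum_range
      (fun x => if edgeRel Δ x j then (F x - F j) * (H x - H j) else 0) n
  simp only [hx]
  rw [Fin.sum_univ_eq_sum_range (fun j => ∑ x ∈ Finset.range n,
      if edgeRel Δ x j then (F x - F j) * (H x - H j) else 0) n,
    ← Finset.sum_range_add_sum_Ico _ hn]
  congr 1
  · have hs : ∀ j ∈ Finset.range 3,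
        (∑ x ∈ Finset.range n, if edgeRel Δ x j then (F x - F j) * (H x - H j) else 0)
          = ∑ x ∈ Finset.range 3, if edgeRel Δ x j then (F x - F j) * (H x - H j) else 0 := by
      intro j hj
      rw [Finset.mem_range] at hj
      rw [← Finset.sum_range_add_sum_Ico _ hn, Finset.sum_eq_zero (s := Finset.Ico 3 n),
        add_zero]
      intro x hx
      rw [Finset.mem_Ico] at hx
      exact if_neg (by unfold edgeRel; omega)
    rw [Finset.sum_congr rfl hs]
    have h0 : ¬ Δ ≤ 0 := by omega
    have h1 : ¬ Δ ≤ 1 := by omega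
    simp [Finset.sum_range_succ, edgeRel, h0, h1]
    ring
  · refine Finset.sum_congr rfl fun j hj => ?_
    rw [Finset.mem_Ico] at hj
    have hp := parent_lt (Δ := Δ) hj.1
    rw [Finset.sum_eq_single (parent Δ j)]
    · rw [if_pos]
      · ring
      · unfold edgeRel parent
        split_ifs <;> omega
    · intro x _ hxp
      refine if_neg fun h => hxp ?_
      unfold edgeRel at h
      unfold parent
      split_ifs <;> omega
    · intro h
      exact absurd (Finset.mem_range.mpr (hp.trans hj.2)) h

/-- The Green function of `P_{n,Δ}^3` grounded at the vertex `2`. -/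
def green (Δ u w : ℕ) : ℝ :=
  if u < 2 ∧ w < 2 then (if u = w then 2 / 3 else 1 / 3)
  else if Δ ≤ u ∧ Δ ≤ w then (min u w : ℕ) - (Δ : ℝ) + 1
  else if u = w ∧ u ≠ 2 then 1 else 0

theorem green_comm (Δ u w : ℕ) : green Δ u w = green Δ w u := by
  simp only [green, and_comm, min_comm u w, eq_comm (a := u)]
  split_ifs <;> first | rfl | omega

theorem green_of_lt {Δ u w : ℕ} (hw : w < Δ) (hu : 3 ≤ u) :
    green Δ u w = if u = w then 1 else 0 := by
  unfold green
  split_ifs <;> first | rfl | omega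

theorem green_of_le {Δ u w : ℕ} (hΔ : 3 ≤ Δ) (hu : Δ ≤ u) (hw : Δ ≤ w) :
    green Δ u w = (min u w : ℕ) - (Δ : ℝ) + 1 := by
  rw [green, if_neg (by omega), if_pos ⟨hu, hw⟩]

theorem green_of_lt_three {Δ u w : ℕ} (hΔ : 3 ≤ Δ) (hu : u < 3) (hw : 2 ≤ w) :
    green Δ u w = 0 := by
  unfold green
  split_ifs <;> first | rfl | omega

theorem sum_green_path {Δ u : ℕ} (hΔ : 3 ≤ Δ) (hu : Δ ≤ u) (F : ℕ → ℝ) (m : ℕ) (hm : 3 ≤ m) :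
    ∑ j ∈ Finset.Ico 3 m,
        (green Δ u j - green Δ u (parent Δ j)) * (F j - F (parent Δ j))
      = if Δ < m then F (min u (m - 1)) - F 2 else 0 := by
  induction m, hm using Nat.le_induction with
  | base => simp [hΔ]
  | succ m hm ih =>
    rw [Finset.sum_Ico_succ_top hm, ih]
    have h2 : green Δ u 2 = 0 := by rw [green_of_lt (by omega) (by omega), if_neg (by omega)]
    rcases lt_trichotomy m Δ with h | rfl | h
    · rw [if_neg (by omega), if_neg (by omega), parent, if_pos h.le, h2,
        green_of_lt h (by omega), if_neg (by omega)]
      ring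
    · rw [if_neg (by omega), if_pos (by omega), parent, if_pos le_rfl, h2,
        green_of_le hΔ hu le_rfl, min_eq_right hu, Nat.add_sub_cancel, min_eq_right hu]
      ring
    · rw [if_pos h, if_pos (by omega), parent, if_neg (by omega), green_of_le hΔ hu h.le,
        green_of_le hΔ hu (by omega), Nat.add_sub_cancel]
      rcases le_or_gt m u with hmu | hmu
      · rw [min_eq_right hmu, min_eq_right (by omega), Nat.cast_sub (by omega)]
        push_cast
        ring
      · rw [min_eq_left hmu.le, min_eq_left (by omega)]
        ring

theorem energyForm_green {n Δ : ℕ} (hΔ : 3 ≤ Δ) (hn : Δ + 1 ≤ n) {u : ℕ} (hu : u < n)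
    (F : ℕ → ℝ) :
    energyForm (PnD3 n Δ) (fun i => green Δ u i) (fun i => F i) = F u - F 2 := by
  rw [energyForm_PnD3 hΔ (by omega)]
  rcases lt_or_ge u 3 with h3 | h3
  · rw [Finset.sum_eq_zero]
    · have h0 : ¬ Δ ≤ 0 := by omega
      have h1 : ¬ Δ ≤ 1 := by omega
      have h2 : ¬ Δ ≤ 2 := by omega
      interval_cases u <;> simp [green, h0, h1, h2] <;> ring
    · intro j hj
      rw [Finset.mem_Ico] at hj
      have hp : 2 ≤ parent Δ j := by
        unfold parent
        split_ifs <;> omega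
      rw [green_of_lt_three hΔ h3 (by omega), green_of_lt_three hΔ h3 hp]
      ring
  · have hz : ∀ w < 3, green Δ u w = 0 := fun w hw => by
      rw [green_of_lt (by omega) h3, if_neg (by omega)]
    rw [hz 0 (by omega), hz 1 (by omega), hz 2 (by omega)]
    rcases lt_or_ge u Δ with hlt | hge
    · have hg : ∀ w, 3 ≤ w → green Δ u w = if w = u then 1 else 0 := fun w hw => by
        rw [green_comm, green_of_lt hlt hw]
      rw [Finset.sum_eq_single u]
      · rw [hg u h3, if_pos rfl, parent, if_pos hlt.le, hz 2 (by omega)]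
        ring
      · intro j hj hju
        rw [Finset.mem_Ico] at hj
        rw [hg j hj.1, if_neg hju, parent]
        split_ifs with hjΔ
        · rw [hz 2 (by omega)]
          ring
        · rw [hg _ (by omega), if_neg (by omega)]
          ring
      · intro h
        exact absurd (Finset.mem_Ico.mpr ⟨h3, hu⟩) h
    · rw [sum_green_path hΔ hge F n (by omega), if_pos (by omega), min_eq_left (by omega)]
      ring

theorem sum_green_row_of_le {Δ u m : ℕ} (hu : 3 ≤ u) (hmΔ : m ≤ Δ) (hmu : m ≤ u) :
    ∑ w ∈ Finset.range m, green Δ u w = 0 := by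
  refine Finset.sum_eq_zero fun w hw => ?_
  rw [Finset.mem_range] at hw
  rw [green_of_lt (by omega) hu, if_neg (by omega)]

theorem sum_green_row {Δ u m : ℕ} (hΔ : 3 ≤ Δ) (hm : Δ ≤ m) (hmu : m ≤ u) :
    ∑ w ∈ Finset.range m, green Δ u w = ((m : ℝ) - Δ) * ((m : ℝ) - Δ + 1) / 2 := by
  induction m, hm using Nat.le_induction with
  | base => rw [sum_green_row_of_le (by omega) le_rfl hmu]; ring
  | succ m hm ih =>
    rw [Finset.sum_range_succ, ih (by omega), green_of_le hΔ (by omega) hm,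
      min_eq_right (by omega)]
    push_cast
    ring

theorem sum_green_diag {Δ m : ℕ} (hΔ : 3 ≤ Δ) (hm : Δ ≤ m) :
    ∑ u ∈ Finset.range m, green Δ u u
      = 4 / 3 + ((Δ : ℝ) - 3) + ((m : ℝ) - Δ) * ((m : ℝ) - Δ + 1) / 2 := by
  have hbase : ∀ k, 3 ≤ k → k ≤ Δ →
      ∑ u ∈ Finset.range k, green Δ u u = 4 / 3 + ((k : ℝ) - 3) := by
    intro k hk
    induction k, hk using Nat.le_induction with
    | base =>
      intro _
      have h2 : ¬ Δ ≤ 2 := by omega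
      simp [Finset.sum_range_succ, green, h2]
      norm_num
    | succ k hk ih =>
      intro hkΔ
      rw [Finset.sum_range_succ, ih (by omega), green_of_lt (by omega) hk, if_pos rfl]
      push_cast
      ring
  induction m, hm using Nat.le_induction with
  | base => rw [hbase Δ hΔ le_rfl]; ring
  | succ m hm ih =>
    rw [Finset.sum_range_succ, ih, green_of_le hΔ hm hm, min_self]
    push_cast
    ring

theorem sum_sum_green_succ (Δ m : ℕ) :
    ∑ u ∈ Finset.range (m + 1), ∑ w ∈ Finset.range (m + 1), green Δ u w
      = ∑ u ∈ Finset.range m, ∑ w ∈ Finset.range m, green Δ u w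
        + 2 * ∑ w ∈ Finset.range m, green Δ m w + green Δ m m := by
  simp only [Finset.sum_range_succ, Finset.sum_add_distrib, green_comm Δ _ m]
  ring

theorem sum_sum_green {Δ m : ℕ} (hΔ : 3 ≤ Δ) (hm : Δ ≤ m) :
    ∑ u ∈ Finset.range m, ∑ w ∈ Finset.range m, green Δ u w
      = 2 + ((Δ : ℝ) - 3)
        + ((m : ℝ) - Δ) * ((m : ℝ) - Δ + 1) * (2 * ((m : ℝ) - Δ) + 1) / 6 := by
  have hbase : ∀ k, 3 ≤ k → k ≤ Δ →
      ∑ u ∈ Finset.range k, ∑ w ∈ Finset.range k, green Δ u w = 2 + ((k : ℝ) - 3) := by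
    intro k hk
    induction k, hk using Nat.le_induction with
    | base =>
      intro _
      have h0 : ¬ Δ ≤ 0 := by omega
      have h1 : ¬ Δ ≤ 1 := by omega
      have h2 : ¬ Δ ≤ 2 := by omega
      simp [Finset.sum_range_succ, green, h0, h1, h2]
      norm_num
    | succ k hk ih =>
      intro hkΔ
      rw [sum_sum_green_succ, ih (by omega), sum_green_row_of_le hk (by omega) le_rfl,
        green_of_lt (by omega) hk, if_pos rfl]
      push_cast
      ring
  induction m, hm using Nat.le_induction with
  | base => rw [hbase Δ hΔ le_rfl]; ring
  | succ m hm ih =>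
    rw [sum_sum_green_succ, ih, sum_green_row hΔ hm le_rfl, green_of_le hΔ hm hm, min_self]
    push_cast
    ring

/-- The closed formula for the Kirchhoff index of `P_{n,Δ}^3`. -/
theorem statement15 (n Δ : ℕ) (hΔ : 3 ≤ Δ) (hn : Δ + 1 ≤ n) :
    kirchhoffIndex (PnD3 n Δ)
      = ((n : ℝ) - Δ + 1) * ((n : ℝ) - Δ + 2) * ((n : ℝ) + 2 * Δ - 9) / 6
        + ((Δ : ℝ) - 3) * ((Δ : ℝ) - 2 / 3) + ((n : ℝ) - Δ) ^ 2
        + 7 * ((n : ℝ) - Δ) / 3 + 2 := by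
  have hK : ∀ (u : Fin n) (f : Fin n → ℝ),
      energyForm (PnD3 n Δ) (fun w => green Δ u w) f = f u - f ⟨2, by omega⟩ := by
    intro u f
    obtain ⟨F, rfl⟩ : ∃ F : ℕ → ℝ, f = fun i : Fin n => F i :=
      ⟨fun i => if h : i < n then f ⟨i, h⟩ else 0, by ext i; simp⟩
    exact energyForm_green hΔ hn u.isLt F
  rw [kirchhoffIndex_eq_of_green _ _ (fun u w : Fin n => green Δ u w) hK, Fintype.card_fin,
    Fin.sum_univ_eq_sum_range (fun u => green Δ u u) n]
  have hrow : ∀ u : Fin n, ∑ w : Fin n, green Δ u w = ∑ w ∈ Finset.range n, green Δ u w :=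
    fun u => Fin.sum_univ_eq_sum_range (fun w => green Δ u w) n
  simp only [hrow]
  rw [Fin.sum_univ_eq_sum_range (fun u => ∑ w ∈ Finset.range n, green Δ u w) n,
    sum_green_diag hΔ (by omega), sum_sum_green hΔ (by omega)]
  ring

end KfPaper
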